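/- Under the Yang–Mills–Higgs setup on ℝⁿ (n > 4), if (A, u) is a Yang–Mills–Higgs pair whose total energy satisfies ∫_{B_R(x₀)} ((1/2)|F_A|² + (1/2)|d^∇u|² + W(|u|²)) dx = o(R^{n−4}) as R → ∞, then F_A ≡ 0, d^∇u ≡ 0, and W(|u|²) ≡ 0; in particular the connection is flat and u is parallel. -/

import Mathlib

open MeasureTheory Set Asymptotics
open scoped RealInnerProductSpace

noncomputable section

section YMH

variable {n : ℕ} {G V : Type*}
  [NormedAddCommGroup G] [InnerProductSpace ℝ G] [FiniteDimensional ℝ G]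
  [NormedAddCommGroup V] [InnerProductSpace ℝ V] [FiniteDimensional ℝ V]

/-- coordinate partial derivative on `ℝⁿ`. -/
def pd18 {F : Type*} [NormedAddCommGroup F] [NormedSpace ℝ F]
    (f : EuclideanSpace ℝ (Fin n) → F) (i : Fin n) (x : EuclideanSpace ℝ (Fin n)) : F :=
  fderiv ℝ f x (EuclideanSpace.single i 1)

/-- curvature `F_{ij} = ∂ᵢAⱼ − ∂ⱼAᵢ + [Aᵢ, Aⱼ]` of the connection with (global,
trivial-bundle) connection form components `A i : ℝⁿ → 𝔤`. -/
def curv18 (br : G →ₗ[ℝ] G →ₗ[ℝ] G) (A : EuclideanSpace ℝ (Fin n) → Fin n → G)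
    (x : EuclideanSpace ℝ (Fin n)) (i j : Fin n) : G :=
  pd18 (fun y => A y j) i x - pd18 (fun y => A y i) j x + br (A x i) (A x j)

/-- covariant derivative `(d^∇u)_i = ∂ᵢu + ρ(Aᵢ)u` of the Higgs field. -/
def covD18 (ρ : G →ₗ[ℝ] V →ₗ[ℝ] V) (A : EuclideanSpace ℝ (Fin n) → Fin n → G)
    (u : EuclideanSpace ℝ (Fin n) → V) (x : EuclideanSpace ℝ (Fin n)) (i : Fin n) : V :=
  pd18 u i x + ρ (A x i) (u x)

/-- Yang–Mills–Higgs energy density `ẽ = ½|F_A|² + ½|d^∇u|² + W(|u|²)`, with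
`|F_A|² = ½ Σ_{i,j} ‖F_{ij}‖²` and `|d^∇u|² = Σᵢ ‖(d^∇u)ᵢ‖²`. -/
def eYMH18 (br : G →ₗ[ℝ] G →ₗ[ℝ] G) (ρ : G →ₗ[ℝ] V →ₗ[ℝ] V)
    (A : EuclideanSpace ℝ (Fin n) → Fin n → G) (u : EuclideanSpace ℝ (Fin n) → V)
    (W : ℝ → ℝ) (x : EuclideanSpace ℝ (Fin n)) : ℝ :=
  (1 / 4) * ∑ i : Fin n, ∑ j : Fin n, ‖curv18 br A x i j‖ ^ 2
    + (1 / 2) * ∑ i : Fin n, ‖covD18 ρ A u x i‖ ^ 2 + W (‖u x‖ ^ 2)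

/-- first Yang–Mills–Higgs equation `δ^∇F_A + u ⊙ d^∇u = 0`, written by pairing with
an arbitrary `X ∈ 𝔤` using `⟨X, e₁ ⊙ e₂⟩ = ⟨ρ(X)e₁, e₂⟩`; here
`(δ^∇F)_j = −Σᵢ(∂ᵢF_{ij} + [Aᵢ, F_{ij}])`. -/
def YMH1 (br : G →ₗ[ℝ] G →ₗ[ℝ] G) (ρ : G →ₗ[ℝ] V →ₗ[ℝ] V)
    (A : EuclideanSpace ℝ (Fin n) → Fin n → G) (u : EuclideanSpace ℝ (Fin n) → V) : Prop :=
  ∀ (x : EuclideanSpace ℝ (Fin n)) (j : Fin n) (X : G),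
    ⟪X, -∑ i : Fin n,
        (pd18 (fun y => curv18 br A y i j) i x + br (A x i) (curv18 br A x i j))⟫
      + ⟪ρ X (u x), covD18 ρ A u x j⟫ = 0

/-- second Yang–Mills–Higgs equation `δ^∇d^∇u + 2W'(|u|²)u = 0`, with
`δ^∇η = −Σᵢ(∂ᵢηᵢ + ρ(Aᵢ)ηᵢ)` for a `V`-valued 1-form `η`. -/
def YMH2 (ρ : G →ₗ[ℝ] V →ₗ[ℝ] V) (A : EuclideanSpace ℝ (Fin n) → Fin n → G)
    (u : EuclideanSpace ℝ (Fin n) → V) (W : ℝ → ℝ) : Prop :=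
  ∀ x : EuclideanSpace ℝ (Fin n),
    (-∑ i : Fin n, (pd18 (fun y => covD18 ρ A u y i) i x + ρ (A x i) (covD18 ρ A u x i)))
      + (2 * deriv W (‖u x‖ ^ 2)) • u x = 0

set_option linter.unusedSectionVars false

lemma pd_add18 {F : Type*} [NormedAddCommGroup F] [NormedSpace ℝ F]
    {f g : EuclideanSpace ℝ (Fin n) → F} (hf : Differentiable ℝ f) (hg : Differentiable ℝ g)
    (i : Fin n) (x : EuclideanSpace ℝ (Fin n)) :
    pd18 (fun y => f y + g y) i x = pd18 f i x + pd18 g i x := by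
  unfold pd18
  rw [show (fun y => f y + g y) = f + g from rfl, fderiv_add (hf x) (hg x)]
  rfl

lemma pd_sub18 {F : Type*} [NormedAddCommGroup F] [NormedSpace ℝ F]
    {f g : EuclideanSpace ℝ (Fin n) → F} (hf : Differentiable ℝ f) (hg : Differentiable ℝ g)
    (i : Fin n) (x : EuclideanSpace ℝ (Fin n)) :
    pd18 (fun y => f y - g y) i x = pd18 f i x - pd18 g i x := by
  unfold pd18
  rw [show (fun y => f y - g y) = f - g from rfl, fderiv_sub (hf x) (hg x)]
  rfl

lemma pd_sum18 {F ι : Type*} [NormedAddCommGroup F] [NormedSpace ℝ F] (s : Finset ι)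
    {f : ι → EuclideanSpace ℝ (Fin n) → F} (hf : ∀ a, Differentiable ℝ (f a))
    (i : Fin n) (x : EuclideanSpace ℝ (Fin n)) :
    pd18 (fun y => ∑ a ∈ s, f a y) i x = ∑ a ∈ s, pd18 (f a) i x := by
  unfold pd18
  rw [fderiv_fun_sum (fun a _ => hf a x)]
  simp

/-- continuous version of a bilinear map. -/
def bil18 {F H K : Type*} [NormedAddCommGroup F] [NormedSpace ℝ F] [FiniteDimensional ℝ F]
    [NormedAddCommGroup H] [NormedSpace ℝ H] [FiniteDimensional ℝ H]
    [NormedAddCommGroup K] [NormedSpace ℝ K] (b : F →ₗ[ℝ] H →ₗ[ℝ] K) : F →L[ℝ] H →L[ℝ] K :=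
  LinearMap.toContinuousLinearMap
    ((LinearMap.toContinuousLinearMap : (H →ₗ[ℝ] K) ≃ₗ[ℝ] (H →L[ℝ] K)).toLinearMap ∘ₗ b)

lemma bil18_apply {F H K : Type*} [NormedAddCommGroup F] [NormedSpace ℝ F] [FiniteDimensional ℝ F]
    [NormedAddCommGroup H] [NormedSpace ℝ H] [FiniteDimensional ℝ H]
    [NormedAddCommGroup K] [NormedSpace ℝ K] (b : F →ₗ[ℝ] H →ₗ[ℝ] K) (x : F) (y : H) :
    bil18 b x y = b x y := rfl

lemma cd_bil18 {F H K : Type*} [NormedAddCommGroup F] [NormedSpace ℝ F] [FiniteDimensional ℝ F]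
    [NormedAddCommGroup H] [NormedSpace ℝ H] [FiniteDimensional ℝ H]
    [NormedAddCommGroup K] [NormedSpace ℝ K] (b : F →ₗ[ℝ] H →ₗ[ℝ] K)
    {f : EuclideanSpace ℝ (Fin n) → F} {g : EuclideanSpace ℝ (Fin n) → H}
    (hf : ContDiff ℝ (⊤ : ℕ∞) f) (hg : ContDiff ℝ (⊤ : ℕ∞) g) :
    ContDiff ℝ (⊤ : ℕ∞) (fun x => b (f x) (g x)) := by
  simp only [← bil18_apply]
  exact ((bil18 b).contDiff.comp hf).clm_apply hg

lemma pd_bil18 {F H K : Type*} [NormedAddCommGroup F] [NormedSpace ℝ F] [FiniteDimensional ℝ F]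
    [NormedAddCommGroup H] [NormedSpace ℝ H] [FiniteDimensional ℝ H]
    [NormedAddCommGroup K] [NormedSpace ℝ K] (b : F →ₗ[ℝ] H →ₗ[ℝ] K)
    {f : EuclideanSpace ℝ (Fin n) → F} {g : EuclideanSpace ℝ (Fin n) → H}
    (hf : Differentiable ℝ f) (hg : Differentiable ℝ g) (i : Fin n)
    (x : EuclideanSpace ℝ (Fin n)) :
    pd18 (fun y => b (f y) (g y)) i x = b (pd18 f i x) (g x) + b (f x) (pd18 g i x) := by
  unfold pd18
  simp only [← bil18_apply]
  rw [(bil18 b).fderiv_of_bilinear (hf x) (hg x)]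
  simp [add_comm]

lemma pd_inner18 {F : Type*} [NormedAddCommGroup F] [InnerProductSpace ℝ F]
    {f g : EuclideanSpace ℝ (Fin n) → F}
    (hf : Differentiable ℝ f) (hg : Differentiable ℝ g) (i : Fin n)
    (x : EuclideanSpace ℝ (Fin n)) :
    pd18 (fun y => ⟪f y, g y⟫) i x = ⟪pd18 f i x, g x⟫ + ⟪f x, pd18 g i x⟫ := by
  unfold pd18
  rw [fderiv_inner_apply ℝ (hf x) (hg x), add_comm]

lemma pd_mul18 {f g : EuclideanSpace ℝ (Fin n) → ℝ}
    (hf : Differentiable ℝ f) (hg : Differentiable ℝ g) (i : Fin n)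
    (x : EuclideanSpace ℝ (Fin n)) :
    pd18 (fun y => f y * g y) i x = pd18 f i x * g x + f x * pd18 g i x := by
  unfold pd18
  rw [fderiv_fun_mul (hf x) (hg x)]
  simp; ring

lemma pd_cd18 {F : Type*} [NormedAddCommGroup F] [NormedSpace ℝ F]
    {f : EuclideanSpace ℝ (Fin n) → F} (hf : ContDiff ℝ (⊤ : ℕ∞) f) (i : Fin n) :
    ContDiff ℝ (⊤ : ℕ∞) (fun x => pd18 f i x) := by
  unfold pd18
  exact (hf.fderiv_right (m := (⊤ : ℕ∞)) (by simp)).clm_apply contDiff_const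

lemma cd_diff18 {F : Type*} [NormedAddCommGroup F] [NormedSpace ℝ F]
    {f : EuclideanSpace ℝ (Fin n) → F} (hf : ContDiff ℝ (⊤ : ℕ∞) f) : Differentiable ℝ f :=
  hf.differentiable (by simp)

lemma pd_comm18 {F : Type*} [NormedAddCommGroup F] [NormedSpace ℝ F]
    {f : EuclideanSpace ℝ (Fin n) → F} (hf : ContDiff ℝ (⊤ : ℕ∞) f) (i j : Fin n)
    (x : EuclideanSpace ℝ (Fin n)) :
    pd18 (fun y => pd18 f i y) j x = pd18 (fun y => pd18 f j y) i x := by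
  have hs : IsSymmSndFDerivAt ℝ f x := (hf.contDiffAt).isSymmSndFDerivAt
    (by simpa using WithTop.coe_le_coe.mpr (le_top : (2 : ℕ∞) ≤ ⊤))
  have hd : Differentiable ℝ (fderiv ℝ f) :=
    (hf.fderiv_right (m := (⊤ : ℕ∞)) (by simp)).differentiable (by simp)
  unfold pd18
  rw [fderiv_clm_apply (hd x) (differentiableAt_const _),
    fderiv_clm_apply (hd x) (differentiableAt_const _)]
  simpa using hs _ _

lemma cd_curv18 (br : G →ₗ[ℝ] G →ₗ[ℝ] G) {A : EuclideanSpace ℝ (Fin n) → Fin n → G}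
    (hA : ∀ i, ContDiff ℝ (⊤ : ℕ∞) (fun x => A x i)) (i j : Fin n) :
    ContDiff ℝ (⊤ : ℕ∞) (fun x => curv18 br A x i j) := by
  unfold curv18
  exact ((pd_cd18 (hA j) i).sub (pd_cd18 (hA i) j)).add (cd_bil18 br (hA i) (hA j))

lemma cd_covD18 (ρ : G →ₗ[ℝ] V →ₗ[ℝ] V) {A : EuclideanSpace ℝ (Fin n) → Fin n → G}
    {u : EuclideanSpace ℝ (Fin n) → V}
    (hA : ∀ i, ContDiff ℝ (⊤ : ℕ∞) (fun x => A x i)) (hu : ContDiff ℝ (⊤ : ℕ∞) u) (i : Fin n) :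
    ContDiff ℝ (⊤ : ℕ∞) (fun x => covD18 ρ A u x i) := by
  unfold covD18
  exact (pd_cd18 hu i).add (cd_bil18 ρ (hA i) hu)

lemma curv_skew18 (br : G →ₗ[ℝ] G →ₗ[ℝ] G) (hbr_skew : ∀ X Y : G, br X Y = -br Y X)
    (A : EuclideanSpace ℝ (Fin n) → Fin n → G) (x : EuclideanSpace ℝ (Fin n)) (i j : Fin n) :
    curv18 br A x i j = - curv18 br A x j i := by
  unfold curv18
  rw [hbr_skew]; abel

/-- covariant derivative of the curvature -/
def nabF18 (br : G →ₗ[ℝ] G →ₗ[ℝ] G) (A : EuclideanSpace ℝ (Fin n) → Fin n → G)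
    (x : EuclideanSpace ℝ (Fin n)) (i j k : Fin n) : G :=
  pd18 (fun y => curv18 br A y j k) i x + br (A x i) (curv18 br A x j k)

/-- second covariant derivative of the field -/
def nabD18 (ρ : G →ₗ[ℝ] V →ₗ[ℝ] V) (A : EuclideanSpace ℝ (Fin n) → Fin n → G)
    (u : EuclideanSpace ℝ (Fin n) → V) (x : EuclideanSpace ℝ (Fin n)) (i j : Fin n) : V :=
  pd18 (fun y => covD18 ρ A u y j) i x + ρ (A x i) (covD18 ρ A u x j)

lemma pd_curv18 (br : G →ₗ[ℝ] G →ₗ[ℝ] G) {A : EuclideanSpace ℝ (Fin n) → Fin n → G}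
    (hA : ∀ i, ContDiff ℝ (⊤ : ℕ∞) (fun x => A x i)) (i j k : Fin n)
    (x : EuclideanSpace ℝ (Fin n)) :
    pd18 (fun y => curv18 br A y j k) i x =
      pd18 (fun y => pd18 (fun z => A z k) j y) i x - pd18 (fun y => pd18 (fun z => A z j) k y) i x
      + (br (pd18 (fun y => A y j) i x) (A x k) + br (A x j) (pd18 (fun y => A y k) i x)) := by
  unfold curv18
  rw [pd_add18 (cd_diff18 ((pd_cd18 (hA k) j).sub (pd_cd18 (hA j) k)))
      (cd_diff18 (cd_bil18 br (hA j) (hA k))),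
    pd_sub18 (cd_diff18 (pd_cd18 (hA k) j)) (cd_diff18 (pd_cd18 (hA j) k)),
    pd_bil18 br (cd_diff18 (hA j)) (cd_diff18 (hA k))]

lemma bianchi18 (br : G →ₗ[ℝ] G →ₗ[ℝ] G)
    (hbr_skew : ∀ X Y : G, br X Y = -br Y X)
    (hjacobi : ∀ X Y Z : G, br X (br Y Z) = br (br X Y) Z + br Y (br X Z))
    {A : EuclideanSpace ℝ (Fin n) → Fin n → G}
    (hA : ∀ i, ContDiff ℝ (⊤ : ℕ∞) (fun x => A x i)) (x : EuclideanSpace ℝ (Fin n))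
    (i j k : Fin n) :
    nabF18 br A x i j k + nabF18 br A x j k i + nabF18 br A x k i j = 0 := by
  unfold nabF18
  simp only [pd_curv18 br hA]
  simp only [curv18, map_add, map_sub]
  rw [pd_comm18 (hA k) i j, pd_comm18 (hA j) k i, pd_comm18 (hA i) j k]
  have e1 := hjacobi (A x i) (A x j) (A x k)
  have e2 := hbr_skew (br (A x i) (A x j)) (A x k)
  have e3 : br (A x j) (br (A x k) (A x i)) = - br (A x j) (br (A x i) (A x k)) := by
    rw [hbr_skew (A x k), map_neg]
  rw [e1, e2, e3]
  rw [hbr_skew (pd18 (fun y => A y j) i x) (A x k), hbr_skew (pd18 (fun y => A y k) j x) (A x i),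
    hbr_skew (pd18 (fun y => A y i) k x) (A x j)]
  abel

lemma comm18 (br : G →ₗ[ℝ] G →ₗ[ℝ] G) (ρ : G →ₗ[ℝ] V →ₗ[ℝ] V)
    (hρ_lie : ∀ X Y : G, ∀ v : V, ρ (br X Y) v = ρ X (ρ Y v) - ρ Y (ρ X v))
    {A : EuclideanSpace ℝ (Fin n) → Fin n → G} {u : EuclideanSpace ℝ (Fin n) → V}
    (hA : ∀ i, ContDiff ℝ (⊤ : ℕ∞) (fun x => A x i)) (hu : ContDiff ℝ (⊤ : ℕ∞) u)
    (x : EuclideanSpace ℝ (Fin n)) (i j : Fin n) :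
    nabD18 ρ A u x i j - nabD18 ρ A u x j i = ρ (curv18 br A x i j) (u x) := by
  unfold nabD18
  have key : ∀ i j : Fin n, pd18 (fun y => covD18 ρ A u y j) i x =
      pd18 (fun y => pd18 u j y) i x +
        (ρ (pd18 (fun y => A y j) i x) (u x) + ρ (A x j) (pd18 u i x)) := by
    intro i j
    unfold covD18
    rw [pd_add18 (cd_diff18 (pd_cd18 hu j)) (cd_diff18 (cd_bil18 ρ (hA j) hu)),
      pd_bil18 ρ (cd_diff18 (hA j)) (cd_diff18 hu)]
  rw [key, key, pd_comm18 hu i j]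
  simp only [curv18, covD18, map_add, map_sub, LinearMap.add_apply, LinearMap.sub_apply, hρ_lie]
  abel

lemma pd_innF18 (br : G →ₗ[ℝ] G →ₗ[ℝ] G)
    (hbr_inv : ∀ X Y Z : G, ⟪br X Y, Z⟫ = -⟪Y, br X Z⟫)
    {A : EuclideanSpace ℝ (Fin n) → Fin n → G}
    (hA : ∀ i, ContDiff ℝ (⊤ : ℕ∞) (fun x => A x i)) (x : EuclideanSpace ℝ (Fin n))
    (i a b c d : Fin n) :
    pd18 (fun y => ⟪curv18 br A y a b, curv18 br A y c d⟫) i x =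
      ⟪nabF18 br A x i a b, curv18 br A x c d⟫ + ⟪curv18 br A x a b, nabF18 br A x i c d⟫ := by
  rw [pd_inner18 (cd_diff18 (cd_curv18 br hA a b)) (cd_diff18 (cd_curv18 br hA c d))]
  unfold nabF18
  rw [inner_add_left, inner_add_right, hbr_inv]
  ring

lemma pd_innD18 (ρ : G →ₗ[ℝ] V →ₗ[ℝ] V)
    (hρ_skew : ∀ (X : G) (v w : V), ⟪ρ X v, w⟫ = -⟪v, ρ X w⟫)
    {A : EuclideanSpace ℝ (Fin n) → Fin n → G} {u : EuclideanSpace ℝ (Fin n) → V}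
    (hA : ∀ i, ContDiff ℝ (⊤ : ℕ∞) (fun x => A x i)) (hu : ContDiff ℝ (⊤ : ℕ∞) u)
    (x : EuclideanSpace ℝ (Fin n)) (i a c : Fin n) :
    pd18 (fun y => ⟪covD18 ρ A u y a, covD18 ρ A u y c⟫) i x =
      ⟪nabD18 ρ A u x i a, covD18 ρ A u x c⟫ + ⟪covD18 ρ A u x a, nabD18 ρ A u x i c⟫ := by
  rw [pd_inner18 (cd_diff18 (cd_covD18 ρ hA hu a)) (cd_diff18 (cd_covD18 ρ hA hu c))]
  unfold nabD18
  rw [inner_add_left, inner_add_right, hρ_skew]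
  ring

lemma pd_W18 (ρ : G →ₗ[ℝ] V →ₗ[ℝ] V)
    (hρ_skew : ∀ (X : G) (v w : V), ⟪ρ X v, w⟫ = -⟪v, ρ X w⟫)
    {A : EuclideanSpace ℝ (Fin n) → Fin n → G} {u : EuclideanSpace ℝ (Fin n) → V}
    {W : ℝ → ℝ} (hu : ContDiff ℝ (⊤ : ℕ∞) u) (hW : ContDiff ℝ (⊤ : ℕ∞) W)
    (x : EuclideanSpace ℝ (Fin n)) (i : Fin n) :
    pd18 (fun y => W (‖u y‖ ^ 2)) i x =
      2 * deriv W (‖u x‖ ^ 2) * ⟪u x, covD18 ρ A u x i⟫ := by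
  have h0 : ⟪u x, ρ (A x i) (u x)⟫ = 0 := by
    have := hρ_skew (A x i) (u x) (u x)
    rw [real_inner_comm] at this
    linarith
  have hd : DifferentiableAt ℝ W (‖u x‖ ^ 2) := hW.differentiable (by simp) _
  have h2 : HasFDerivAt (fun y => ‖u y‖ ^ 2) _ x :=
    ((cd_diff18 hu) x).hasFDerivAt.norm_sq
  have h3 := hd.hasDerivAt.comp_hasFDerivAt x h2
  unfold pd18 covD18
  rw [inner_add_right, h0]
  have h4 : fderiv ℝ (fun y => W (‖u y‖ ^ 2)) x = _ := h3.fderiv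
  rw [h4]
  simp [pd18]
  ring

lemma eYMH_inner18 (br : G →ₗ[ℝ] G →ₗ[ℝ] G) (ρ : G →ₗ[ℝ] V →ₗ[ℝ] V)
    (A : EuclideanSpace ℝ (Fin n) → Fin n → G) (u : EuclideanSpace ℝ (Fin n) → V)
    (W : ℝ → ℝ) : eYMH18 br ρ A u W = fun x =>
  (∑ i : Fin n, ∑ j : Fin n, (1 / 4) * ⟪curv18 br A x i j, curv18 br A x i j⟫)
    + (∑ i : Fin n, (1 / 2) * ⟪covD18 ρ A u x i, covD18 ρ A u x i⟫) + W (‖u x‖ ^ 2) := by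
  ext x
  simp only [eYMH18, real_inner_self_eq_norm_sq, Finset.mul_sum]

lemma cd_W18 {u : EuclideanSpace ℝ (Fin n) → V}
    {W : ℝ → ℝ} (hu : ContDiff ℝ (⊤ : ℕ∞) u) (hW : ContDiff ℝ (⊤ : ℕ∞) W) :
    ContDiff ℝ (⊤ : ℕ∞) (fun x => W (‖u x‖ ^ 2)) := hW.comp (hu.norm_sq ℝ)

lemma cd_e18 (br : G →ₗ[ℝ] G →ₗ[ℝ] G) (ρ : G →ₗ[ℝ] V →ₗ[ℝ] V)
    {A : EuclideanSpace ℝ (Fin n) → Fin n → G} {u : EuclideanSpace ℝ (Fin n) → V}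
    {W : ℝ → ℝ} (hA : ∀ i, ContDiff ℝ (⊤ : ℕ∞) (fun x => A x i)) (hu : ContDiff ℝ (⊤ : ℕ∞) u)
    (hW : ContDiff ℝ (⊤ : ℕ∞) W) : ContDiff ℝ (⊤ : ℕ∞) (eYMH18 br ρ A u W) := by
  rw [eYMH_inner18]
  refine ContDiff.add (ContDiff.add ?_ ?_) (cd_W18 hu hW)
  · exact ContDiff.sum fun i _ => ContDiff.sum fun j _ => contDiff_const.mul
      ((cd_curv18 br hA i j).inner ℝ (cd_curv18 br hA i j))
  · exact ContDiff.sum fun i _ => contDiff_const.mul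
      ((cd_covD18 ρ hA hu i).inner ℝ (cd_covD18 ρ hA hu i))

lemma pd_cmul18 {f : EuclideanSpace ℝ (Fin n) → ℝ} (c : ℝ)
    (hf : Differentiable ℝ f) (i : Fin n) (x : EuclideanSpace ℝ (Fin n)) :
    pd18 (fun y => c * f y) i x = c * pd18 f i x := by
  unfold pd18
  rw [fderiv_const_mul (hf x)]
  simp

lemma pd_e18 (br : G →ₗ[ℝ] G →ₗ[ℝ] G) (ρ : G →ₗ[ℝ] V →ₗ[ℝ] V)
    (hbr_inv : ∀ X Y Z : G, ⟪br X Y, Z⟫ = -⟪Y, br X Z⟫)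
    (hρ_skew : ∀ (X : G) (v w : V), ⟪ρ X v, w⟫ = -⟪v, ρ X w⟫)
    {A : EuclideanSpace ℝ (Fin n) → Fin n → G} {u : EuclideanSpace ℝ (Fin n) → V}
    {W : ℝ → ℝ} (hA : ∀ i, ContDiff ℝ (⊤ : ℕ∞) (fun x => A x i)) (hu : ContDiff ℝ (⊤ : ℕ∞) u)
    (hW : ContDiff ℝ (⊤ : ℕ∞) W) (x : EuclideanSpace ℝ (Fin n)) (j : Fin n) :
    pd18 (eYMH18 br ρ A u W) j x =
      (1 / 2) * ∑ i, ∑ k, ⟪curv18 br A x i k, nabF18 br A x j i k⟫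
      + ∑ i, ⟪covD18 ρ A u x i, nabD18 ρ A u x j i⟫
      + 2 * deriv W (‖u x‖ ^ 2) * ⟪u x, covD18 ρ A u x j⟫ := by
  have c1 : ∀ i k, ContDiff ℝ (⊤ : ℕ∞) (fun x => ⟪curv18 br A x i k, curv18 br A x i k⟫) :=
    fun i k => ((cd_curv18 br hA i k).inner ℝ (cd_curv18 br hA i k))
  have c2 : ∀ i, ContDiff ℝ (⊤ : ℕ∞) (fun x => ⟪covD18 ρ A u x i, covD18 ρ A u x i⟫) :=
    fun i => ((cd_covD18 ρ hA hu i).inner ℝ (cd_covD18 ρ hA hu i))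
  have d1 : ∀ i k, ContDiff ℝ (⊤ : ℕ∞)
      (fun x => (1 / 4 : ℝ) * ⟪curv18 br A x i k, curv18 br A x i k⟫) :=
    fun i k => contDiff_const.mul (c1 i k)
  have d2 : ∀ i, ContDiff ℝ (⊤ : ℕ∞)
      (fun x => (1 / 2 : ℝ) * ⟪covD18 ρ A u x i, covD18 ρ A u x i⟫) :=
    fun i => contDiff_const.mul (c2 i)
  have s1 : ∀ i, ContDiff ℝ (⊤ : ℕ∞)
      (fun x => ∑ k, (1 / 4 : ℝ) * ⟪curv18 br A x i k, curv18 br A x i k⟫) :=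
    fun i => ContDiff.sum fun k _ => d1 i k
  have s11 := ContDiff.sum (s := Finset.univ) fun i (_ : i ∈ Finset.univ) => s1 i
  have s2 := ContDiff.sum (s := Finset.univ) fun i (_ : i ∈ Finset.univ) => d2 i
  rw [eYMH_inner18, pd_add18 (cd_diff18 (s11.add s2)) (cd_diff18 (cd_W18 hu hW)),
    pd_add18 (cd_diff18 s11) (cd_diff18 s2), pd_sum18 _ (fun i => cd_diff18 (s1 i)),
    pd_sum18 _ (fun i => cd_diff18 (d2 i)), pd_W18 ρ hρ_skew (A := A) hu hW, Finset.mul_sum]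
  congr 2
  · refine Finset.sum_congr rfl fun i _ => ?_
    rw [pd_sum18 _ (fun k => cd_diff18 (d1 i k)), Finset.mul_sum]
    refine Finset.sum_congr rfl fun k _ => ?_
    rw [pd_cmul18 _ (cd_diff18 (c1 i k)), pd_innF18 br hbr_inv hA, real_inner_comm]
    ring
  · refine Finset.sum_congr rfl fun i _ => ?_
    rw [pd_cmul18 _ (cd_diff18 (c2 i)), pd_innD18 ρ hρ_skew hA hu, real_inner_comm]
    ring

/-- the stress-energy tensor without the trace part -/
def S18 (br : G →ₗ[ℝ] G →ₗ[ℝ] G) (ρ : G →ₗ[ℝ] V →ₗ[ℝ] V)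
    (A : EuclideanSpace ℝ (Fin n) → Fin n → G) (u : EuclideanSpace ℝ (Fin n) → V)
    (i j : Fin n) (x : EuclideanSpace ℝ (Fin n)) : ℝ :=
  (∑ k, ⟪curv18 br A x i k, curv18 br A x j k⟫) + ⟪covD18 ρ A u x i, covD18 ρ A u x j⟫

lemma cd_S18 (br : G →ₗ[ℝ] G →ₗ[ℝ] G) (ρ : G →ₗ[ℝ] V →ₗ[ℝ] V)
    {A : EuclideanSpace ℝ (Fin n) → Fin n → G} {u : EuclideanSpace ℝ (Fin n) → V}
    (hA : ∀ i, ContDiff ℝ (⊤ : ℕ∞) (fun x => A x i)) (hu : ContDiff ℝ (⊤ : ℕ∞) u)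
    (i j : Fin n) : ContDiff ℝ (⊤ : ℕ∞) (S18 br ρ A u i j) := by
  unfold S18
  exact ContDiff.add (ContDiff.sum fun k _ => (cd_curv18 br hA i k).inner ℝ (cd_curv18 br hA j k))
    ((cd_covD18 ρ hA hu i).inner ℝ (cd_covD18 ρ hA hu j))

lemma div18 (br : G →ₗ[ℝ] G →ₗ[ℝ] G) (ρ : G →ₗ[ℝ] V →ₗ[ℝ] V)
    (hbr_skew : ∀ X Y : G, br X Y = -br Y X)
    (hjacobi : ∀ X Y Z : G, br X (br Y Z) = br (br X Y) Z + br Y (br X Z))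
    (hbr_inv : ∀ X Y Z : G, ⟪br X Y, Z⟫ = -⟪Y, br X Z⟫)
    (hρ_lie : ∀ X Y : G, ∀ v : V, ρ (br X Y) v = ρ X (ρ Y v) - ρ Y (ρ X v))
    (hρ_skew : ∀ (X : G) (v w : V), ⟪ρ X v, w⟫ = -⟪v, ρ X w⟫)
    {A : EuclideanSpace ℝ (Fin n) → Fin n → G} {u : EuclideanSpace ℝ (Fin n) → V}
    {W : ℝ → ℝ} (hA : ∀ i, ContDiff ℝ (⊤ : ℕ∞) (fun x => A x i)) (hu : ContDiff ℝ (⊤ : ℕ∞) u)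
    (hW : ContDiff ℝ (⊤ : ℕ∞) W)
    (h1 : YMH1 br ρ A u) (h2 : YMH2 ρ A u W) (x : EuclideanSpace ℝ (Fin n)) (j : Fin n) :
    pd18 (eYMH18 br ρ A u W) j x = ∑ i, pd18 (S18 br ρ A u i j) i x := by
  have c1 : ∀ i k, ContDiff ℝ (⊤ : ℕ∞) (fun x => ⟪curv18 br A x i k, curv18 br A x j k⟫) :=
    fun i k => ((cd_curv18 br hA i k).inner ℝ (cd_curv18 br hA j k))
  have c2 : ∀ i, ContDiff ℝ (⊤ : ℕ∞) (fun x => ⟪covD18 ρ A u x i, covD18 ρ A u x j⟫) :=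
    fun i => ((cd_covD18 ρ hA hu i).inner ℝ (cd_covD18 ρ hA hu j))
  have e1 : ∀ i, pd18 (S18 br ρ A u i j) i x =
      (∑ k, ⟪nabF18 br A x i i k, curv18 br A x j k⟫)
      + (∑ k, ⟪curv18 br A x i k, nabF18 br A x i j k⟫)
      + ⟪nabD18 ρ A u x i i, covD18 ρ A u x j⟫ + ⟪covD18 ρ A u x i, nabD18 ρ A u x i j⟫ := by
    intro i
    unfold S18
    rw [pd_add18 (cd_diff18 (ContDiff.sum fun k _ => c1 i k)) (cd_diff18 (c2 i)),
      pd_sum18 _ (fun k => cd_diff18 (c1 i k)), pd_innD18 ρ hρ_skew hA hu,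
      ← Finset.sum_add_distrib]
    simp only [pd_innF18 br hbr_inv hA]
    ring
  simp only [e1, Finset.sum_add_distrib]
  rw [pd_e18 br ρ hbr_inv hρ_skew hA hu hW]
  -- Bianchi
  have e2 : (1 / 2) * ∑ i, ∑ k, ⟪curv18 br A x i k, nabF18 br A x j i k⟫ =
      ∑ i, ∑ k, ⟪curv18 br A x i k, nabF18 br A x i j k⟫ := by
    have sk : ∀ i a b, nabF18 br A x i a b = - nabF18 br A x i b a := by
      intro i a b
      unfold nabF18
      have : (fun y => curv18 br A y a b) = fun y => - curv18 br A y b a := by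
        ext y; exact curv_skew18 br hbr_skew A y a b
      rw [this, curv_skew18 br hbr_skew A x a b, map_neg]
      unfold pd18
      rw [fderiv_fun_neg]
      simp; abel
    have b1 : ∀ i k, ⟪curv18 br A x i k, nabF18 br A x j i k⟫ =
        ⟪curv18 br A x i k, nabF18 br A x i j k⟫ + ⟪curv18 br A x k i, nabF18 br A x k j i⟫ := by
      intro i k
      have hb := bianchi18 br hbr_skew hjacobi hA x j i k
      rw [curv_skew18 br hbr_skew A x k i, inner_neg_left, ← sub_eq_add_neg, ← inner_sub_right]
      congr 1
      rw [sk i k j] at hb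
      have := eq_neg_of_add_eq_zero_left hb
      rw [← sub_eq_zero, ← hb]; abel
    simp only [b1, Finset.sum_add_distrib]
    rw [Finset.sum_comm (f := fun i k => ⟪curv18 br A x k i, nabF18 br A x k j i⟫)]
    ring
  have e3 : ∑ i, ⟪covD18 ρ A u x i, nabD18 ρ A u x j i⟫ =
      ∑ i, ⟪covD18 ρ A u x i, nabD18 ρ A u x i j⟫
        + ∑ i, ⟪covD18 ρ A u x i, ρ (curv18 br A x j i) (u x)⟫ := by
    rw [← Finset.sum_add_distrib]
    refine Finset.sum_congr rfl fun i _ => ?_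
    rw [← comm18 br ρ hρ_lie hA hu, ← inner_add_right]
    congr 1; abel
  have e4 : ∑ i, ∑ k, ⟪nabF18 br A x i i k, curv18 br A x j k⟫ =
      ∑ k, ⟪covD18 ρ A u x k, ρ (curv18 br A x j k) (u x)⟫ := by
    rw [Finset.sum_comm]
    refine Finset.sum_congr rfl fun k _ => ?_
    have := h1 x k (curv18 br A x j k)
    rw [inner_neg_right, inner_sum] at this
    rw [real_inner_comm]
    have h : ∀ i, ⟪nabF18 br A x i i k, curv18 br A x j k⟫ = ⟪curv18 br A x j k, 
      pd18 (fun y => curv18 br A y i k) i x + br (A x i) (curv18 br A x i k)⟫ := fun i =>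
        real_inner_comm _ _
    simp only [h]
    linarith
  have e5 : ∑ i, ⟪nabD18 ρ A u x i i, covD18 ρ A u x j⟫ =
      2 * deriv W (‖u x‖ ^ 2) * ⟪u x, covD18 ρ A u x j⟫ := by
    have := h2 x
    rw [← sum_inner, ← real_inner_smul_left]
    congr 1
    rw [neg_add_eq_zero] at this
    exact this
  rw [e2, e3, e4, e5]
  ring

lemma pd_cpt18 {f : EuclideanSpace ℝ (Fin n) → ℝ} (hs : HasCompactSupport f) (i : Fin n) :
    HasCompactSupport (fun x => pd18 f i x) := by
  unfold pd18
  exact (hs.fderiv (𝕜 := ℝ)).comp_left (g := fun L => L (EuclideanSpace.single i 1)) rfl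

lemma int_pd18 {f : EuclideanSpace ℝ (Fin n) → ℝ} (hf : ContDiff ℝ (⊤ : ℕ∞) f)
    (hs : HasCompactSupport f) (i : Fin n) :
    Integrable (fun x => pd18 f i x) ∧ ∫ x, pd18 f i x = 0 := by
  have h1 : Integrable (fun x => pd18 f i x) :=
    (pd_cd18 hf i).continuous.integrable_of_hasCompactSupport (pd_cpt18 hs i)
  refine ⟨h1, ?_⟩
  have h2 : Integrable f := hf.continuous.integrable_of_hasCompactSupport hs
  have := integral_mul_fderiv_eq_neg_fderiv_mul_of_integrable (𝕜 := ℝ)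
    (μ := (volume : Measure (EuclideanSpace ℝ (Fin n))))
    (f := fun _ => (1 : ℝ)) (g := f) (v := EuclideanSpace.single i 1)
    (by simp) (by simpa [pd18] using h1) (by simpa using h2)
    (fun x _ => differentiableAt_const _) (fun x _ => cd_diff18 hf x)
  simpa [pd18] using this

lemma stress18 (br : G →ₗ[ℝ] G →ₗ[ℝ] G) (ρ : G →ₗ[ℝ] V →ₗ[ℝ] V)
    (hbr_skew : ∀ X Y : G, br X Y = -br Y X)
    (hjacobi : ∀ X Y Z : G, br X (br Y Z) = br (br X Y) Z + br Y (br X Z))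
    (hbr_inv : ∀ X Y Z : G, ⟪br X Y, Z⟫ = -⟪Y, br X Z⟫)
    (hρ_lie : ∀ X Y : G, ∀ v : V, ρ (br X Y) v = ρ X (ρ Y v) - ρ Y (ρ X v))
    (hρ_skew : ∀ (X : G) (v w : V), ⟪ρ X v, w⟫ = -⟪v, ρ X w⟫)
    {A : EuclideanSpace ℝ (Fin n) → Fin n → G} {u : EuclideanSpace ℝ (Fin n) → V}
    {W : ℝ → ℝ} (hA : ∀ i, ContDiff ℝ (⊤ : ℕ∞) (fun x => A x i)) (hu : ContDiff ℝ (⊤ : ℕ∞) u)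
    (hW : ContDiff ℝ (⊤ : ℕ∞) W)
    (h1 : YMH1 br ρ A u) (h2 : YMH2 ρ A u W)
    (X : Fin n → EuclideanSpace ℝ (Fin n) → ℝ) (hX : ∀ j, ContDiff ℝ (⊤ : ℕ∞) (X j))
    (hc : ∀ j, HasCompactSupport (X j)) :
    Integrable (fun x => ∑ j, (eYMH18 br ρ A u W x * pd18 (X j) j x
      - ∑ i, S18 br ρ A u i j x * pd18 (X j) i x)) ∧
    ∫ x, ∑ j, (eYMH18 br ρ A u W x * pd18 (X j) j x
      - ∑ i, S18 br ρ A u i j x * pd18 (X j) i x) = 0 := by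
  have he := cd_e18 br ρ hA hu hW
  have hS := cd_S18 br ρ hA hu
  have heq : (fun x => ∑ j, (eYMH18 br ρ A u W x * pd18 (X j) j x
      - ∑ i, S18 br ρ A u i j x * pd18 (X j) i x)) = fun x => ∑ j,
        (pd18 (fun y => eYMH18 br ρ A u W y * X j y) j x
          - ∑ i, pd18 (fun y => S18 br ρ A u i j y * X j y) i x) := by
    ext x
    refine Finset.sum_congr rfl fun j _ => ?_
    rw [pd_mul18 (cd_diff18 he) (cd_diff18 (hX j))]
    simp only [pd_mul18 (cd_diff18 (hS _ _)) (cd_diff18 (hX _))]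
    rw [Finset.sum_add_distrib, ← Finset.sum_mul,
      div18 br ρ hbr_skew hjacobi hbr_inv hρ_lie hρ_skew hA hu hW h1 h2]
    ring
  have k1 := fun j => int_pd18 (f := fun y => eYMH18 br ρ A u W y * X j y) (he.mul (hX j))
    ((hc j).mul_left) j
  have k2 := fun j i => int_pd18 (f := fun y => S18 br ρ A u i j y * X j y) ((hS i j).mul (hX j))
    ((hc j).mul_left) i
  have k3 : ∀ j, Integrable (fun x => ∑ i, pd18 (fun y => S18 br ρ A u i j y * X j y) i x) :=
    fun j => integrable_finsetSum _ fun i _ => (k2 j i).1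
  rw [heq]
  refine ⟨integrable_finsetSum _ fun j _ => (k1 j).1.sub (k3 j), ?_⟩
  have k4 : ∀ j, Integrable (fun x => pd18 (fun y => eYMH18 br ρ A u W y * X j y) j x
      - ∑ i, pd18 (fun y => S18 br ρ A u i j y * X j y) i x) := fun j => (k1 j).1.sub (k3 j)
  rw [integral_finsetSum _ fun j _ => k4 j]
  refine Finset.sum_eq_zero fun j _ => ?_
  rw [integral_sub (k1 j).1 (k3 j), (k1 j).2, integral_finsetSum _ fun i _ => (k2 j i).1]
  simp [(k2 j _).2]

lemma S_quad18 (br : G →ₗ[ℝ] G →ₗ[ℝ] G) (ρ : G →ₗ[ℝ] V →ₗ[ℝ] V)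
    (A : EuclideanSpace ℝ (Fin n) → Fin n → G) (u : EuclideanSpace ℝ (Fin n) → V)
    (x : EuclideanSpace ℝ (Fin n)) (z : Fin n → ℝ) :
    0 ≤ ∑ j, ∑ i, S18 br ρ A u i j x * (z i * z j) := by
  have : ∑ j, ∑ i, S18 br ρ A u i j x * (z i * z j) =
      (∑ k, ⟪∑ i, z i • curv18 br A x i k, ∑ j, z j • curv18 br A x j k⟫) +
      ⟪∑ i, z i • covD18 ρ A u x i, ∑ j, z j • covD18 ρ A u x j⟫ := by
    simp only [sum_inner, inner_sum, real_inner_smul_left, real_inner_smul_right, S18, add_mul,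
      Finset.sum_add_distrib, Finset.sum_mul]
    congr 1
    · rw [Finset.sum_comm (s := Finset.univ (α := Fin n))
        (f := fun k j => ∑ i, z j * (z i * ⟪curv18 br A x i k, curv18 br A x j k⟫))]
      refine Finset.sum_congr rfl fun i _ => ?_
      rw [Finset.sum_comm]
      refine Finset.sum_congr rfl fun k _ => Finset.sum_congr rfl fun j _ => ?_
      ring
    · refine Finset.sum_congr rfl fun k _ => Finset.sum_congr rfl fun j _ => ?_
      ring
  rw [this]
  exact add_nonneg (Finset.sum_nonneg fun k _ => real_inner_self_nonneg) real_inner_self_nonneg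

lemma S_tr18 (br : G →ₗ[ℝ] G →ₗ[ℝ] G) (ρ : G →ₗ[ℝ] V →ₗ[ℝ] V)
    (A : EuclideanSpace ℝ (Fin n) → Fin n → G) (u : EuclideanSpace ℝ (Fin n) → V)
    {W : ℝ → ℝ} (hWpos : ∀ t, 0 ≤ W t) (x : EuclideanSpace ℝ (Fin n)) :
    ∑ j, S18 br ρ A u j j x ≤ 4 * eYMH18 br ρ A u W x := by
  unfold S18 eYMH18
  simp only [real_inner_self_eq_norm_sq, Finset.sum_add_distrib]
  have := hWpos (‖u x‖ ^ 2)
  have : 0 ≤ ∑ i, ‖covD18 ρ A u x i‖ ^ 2 := Finset.sum_nonneg fun i _ => sq_nonneg _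
  linarith

lemma e_nonneg18 (br : G →ₗ[ℝ] G →ₗ[ℝ] G) (ρ : G →ₗ[ℝ] V →ₗ[ℝ] V)
    (A : EuclideanSpace ℝ (Fin n) → Fin n → G) (u : EuclideanSpace ℝ (Fin n) → V)
    {W : ℝ → ℝ} (hWpos : ∀ t, 0 ≤ W t) (x : EuclideanSpace ℝ (Fin n)) :
    0 ≤ eYMH18 br ρ A u W x := by
  unfold eYMH18
  have := hWpos (‖u x‖ ^ 2)
  positivity

lemma ineq18 (br : G →ₗ[ℝ] G →ₗ[ℝ] G) (ρ : G →ₗ[ℝ] V →ₗ[ℝ] V)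
    (hbr_skew : ∀ X Y : G, br X Y = -br Y X)
    (hjacobi : ∀ X Y Z : G, br X (br Y Z) = br (br X Y) Z + br Y (br X Z))
    (hbr_inv : ∀ X Y Z : G, ⟪br X Y, Z⟫ = -⟪Y, br X Z⟫)
    (hρ_lie : ∀ X Y : G, ∀ v : V, ρ (br X Y) v = ρ X (ρ Y v) - ρ Y (ρ X v))
    (hρ_skew : ∀ (X : G) (v w : V), ⟪ρ X v, w⟫ = -⟪v, ρ X w⟫)
    {A : EuclideanSpace ℝ (Fin n) → Fin n → G} {u : EuclideanSpace ℝ (Fin n) → V}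
    {W : ℝ → ℝ} (hA : ∀ i, ContDiff ℝ (⊤ : ℕ∞) (fun x => A x i)) (hu : ContDiff ℝ (⊤ : ℕ∞) u)
    (hW : ContDiff ℝ (⊤ : ℕ∞) W) (hWpos : ∀ t, 0 ≤ W t)
    (h1 : YMH1 br ρ A u) (h2 : YMH2 ρ A u W) (x₀ : EuclideanSpace ℝ (Fin n))
    (φ φ' : ℝ → ℝ) (hφ : ContDiff ℝ (⊤ : ℕ∞) fun x : EuclideanSpace ℝ (Fin n) => φ (‖x - x₀‖ ^ 2))
    (hφc : HasCompactSupport fun x : EuclideanSpace ℝ (Fin n) => φ (‖x - x₀‖ ^ 2))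
    (hφd : ∀ s, 0 ≤ s → HasDerivAt φ (φ' s) s) (hφ0 : ∀ s, 0 ≤ s → 0 ≤ φ s)
    (hφ1 : ∀ s, 0 ≤ s → φ' s ≤ 0) :
    ∃ I : EuclideanSpace ℝ (Fin n) → ℝ, Integrable I ∧ ∫ x, I x = 0 ∧
      ∀ x, (((n : ℝ) - 4) * φ (‖x - x₀‖ ^ 2) + 2 * ‖x - x₀‖ ^ 2 * φ' (‖x - x₀‖ ^ 2))
        * eYMH18 br ρ A u W x ≤ I x := by
  have hcoord : ∀ j, ContDiff ℝ (⊤ : ℕ∞) (fun x : EuclideanSpace ℝ (Fin n) => x j - x₀ j) :=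
    fun j => by fun_prop
  have hst := stress18 br ρ hbr_skew hjacobi hbr_inv hρ_lie hρ_skew hA hu hW h1 h2
    (fun j x => φ (‖x - x₀‖ ^ 2) * (x j - x₀ j)) (fun j => hφ.mul (hcoord j))
    (fun j => hφc.mul_right)
  refine ⟨_, hst.1, hst.2, fun x => ?_⟩
  have p1 : ∀ i, pd18 (fun x : EuclideanSpace ℝ (Fin n) => φ (‖x - x₀‖ ^ 2)) i x =
      2 * φ' (‖x - x₀‖ ^ 2) * (x i - x₀ i) := by
    intro i
    have g1 : HasFDerivAt (fun y : EuclideanSpace ℝ (Fin n) => ‖y - x₀‖ ^ 2) _ x :=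
      ((hasFDerivAt_id x).sub_const x₀).norm_sq
    have g2 := (hφd (‖x - x₀‖ ^ 2) (sq_nonneg _)).comp_hasFDerivAt x g1
    have g3 : fderiv ℝ (fun x : EuclideanSpace ℝ (Fin n) => φ (‖x - x₀‖ ^ 2)) x = _ := g2.fderiv
    unfold pd18
    rw [g3]
    simp [EuclideanSpace.inner_single_right]
    ring
  have p2 : ∀ i j, pd18 (fun x : EuclideanSpace ℝ (Fin n) => x j - x₀ j) i x =
      if i = j then 1 else 0 := by
    intro i j
    unfold pd18
    rw [fderiv_sub_const]
    have : fderiv ℝ (fun x : EuclideanSpace ℝ (Fin n) => x j) x = EuclideanSpace.proj j :=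
      (EuclideanSpace.proj j : EuclideanSpace ℝ (Fin n) →L[ℝ] ℝ).hasFDerivAt.fderiv
    rw [this]
    simp [eq_comm]
  have p3 : ∀ i j, pd18 (fun x : EuclideanSpace ℝ (Fin n) => φ (‖x - x₀‖ ^ 2) * (x j - x₀ j)) i x
      = 2 * φ' (‖x - x₀‖ ^ 2) * ((x i - x₀ i) * (x j - x₀ j))
        + φ (‖x - x₀‖ ^ 2) * (if i = j then 1 else 0) := by
    intro i j
    rw [pd_mul18 (cd_diff18 hφ) (cd_diff18 (hcoord j)), p1, p2]
    ring
  simp only [p3]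
  have hz : ‖x - x₀‖ ^ 2 = ∑ j, (x j - x₀ j) * (x j - x₀ j) := by
    rw [EuclideanSpace.norm_sq_eq]
    simp [sq]
  set s := ‖x - x₀‖ ^ 2 with hs
  have hs0 : 0 ≤ s := sq_nonneg _
  set e := eYMH18 br ρ A u W x
  have hq := S_quad18 br ρ A u x (fun i => x i - x₀ i)
  have ht := S_tr18 br ρ A u hWpos x
  have hI : ∀ z : Fin n → ℝ, ∑ j, (e * (2 * φ' s * (z j * z j) + φ s * 1)
      - ∑ i, S18 br ρ A u i j x * (2 * φ' s * (z i * z j)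
          + φ s * (if i = j then 1 else 0)))
      = φ s * (n * e - ∑ j, S18 br ρ A u j j x) + 2 * φ' s * (e * (∑ j, z j * z j)
        - ∑ j, ∑ i, S18 br ρ A u i j x * (z i * z j)) := by
    intro z
    have a1 : ∀ i j, S18 br ρ A u i j x * (2 * φ' s * (z i * z j))
      = 2 * φ' s * (S18 br ρ A u i j x * (z i * z j)) := fun i j => by ring
    have a2 : ∀ j, e * (2 * φ' s * (z j * z j))
      = 2 * φ' s * (e * (z j * z j)) := fun j => by ring
    have a3 : ∀ j, S18 br ρ A u j j x * φ s = φ s * S18 br ρ A u j j x := fun j => by ring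
    simp only [mul_add, Finset.sum_sub_distrib, Finset.sum_add_distrib, mul_ite, mul_one, mul_zero,
      Finset.sum_ite_eq', Finset.mem_univ, if_true, a1, a2, a3, ← Finset.mul_sum]
    simp only [Finset.sum_const, Finset.card_univ, Fintype.card_fin, nsmul_eq_mul]
    ring
  replace hI := hI (fun i => x i - x₀ i)
  rw [← hz] at hI
  simp only [if_true]
  refine le_trans ?_ hI.ge
  have := mul_nonneg (hφ0 s hs0) (sub_nonneg.2 ht)
  have := mul_nonneg (neg_nonneg.2 (hφ1 s hs0)) hq
  nlinarith

lemma cut18 (m : ℝ) (hm : 0 < m) : ∃ C : ℝ, 0 ≤ C ∧ ∀ R : ℝ, 1 ≤ R → ∃ φ φ' : ℝ → ℝ,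
    (∀ s, 0 ≤ s → ContDiffAt ℝ (⊤ : ℕ∞) φ s) ∧ (∀ s, 4 * R ^ 2 ≤ s → φ s = 0) ∧
    (∀ s, 0 ≤ s → HasDerivAt φ (φ' s) s) ∧ (∀ s, 0 ≤ s → 0 ≤ φ s) ∧ (∀ s, 0 ≤ s → φ' s ≤ 0) ∧
    (∀ s, 0 ≤ s → s < R ^ 2 → m * φ s + 2 * s * φ' s = m * (1 + s) ^ (-(m / 2) - 1)) ∧
    (∀ s, 0 ≤ s → -(C * R ^ (-m)) ≤ m * φ s + 2 * s * φ' s) ∧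
    (∀ s, 4 * R ^ 2 ≤ s → m * φ s + 2 * s * φ' s = 0) := by
  let q : ℝ → ℝ := fun t => Real.smoothTransition (2 - t)
  have hq : ContDiff ℝ (⊤ : ℕ∞) q :=
    Real.smoothTransition.contDiff.comp (contDiff_const.sub contDiff_id)
  have hqd : ∀ t, HasDerivAt q (deriv q t) t := fun t =>
    (hq.differentiable (by simp) t).hasDerivAt
  have hqc : Continuous (deriv q) := hq.continuous_deriv (by simp)
  have hqa : Antitone q := fun a b hab => Real.smoothTransition.monotone (by linarith)
  have hq' : ∀ t, deriv q t ≤ 0 := fun t => hqa.deriv_nonpos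
  have hq0 : ∀ t, 0 ≤ q t := fun t => Real.smoothTransition.nonneg _
  have hq1 : ∀ t, t ≤ 1 → q t = 1 := fun t ht =>
    Real.smoothTransition.one_of_one_le (by linarith)
  have hq2 : ∀ t, 2 ≤ t → q t = 0 := fun t ht =>
    Real.smoothTransition.zero_of_nonpos (by linarith)
  have hd1 : ∀ t, t < 1 → deriv q t = 0 := by
    intro t ht
    have : q =ᶠ[nhds t] fun _ => 1 := by
      filter_upwards [gt_mem_nhds ht] with y hy using hq1 y hy.le
    rw [this.deriv_eq]; simp
  have hd2 : ∀ t, 2 < t → deriv q t = 0 := by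
    intro t ht
    have : q =ᶠ[nhds t] fun _ => 0 := by
      filter_upwards [lt_mem_nhds ht] with y hy using hq2 y hy.le
    rw [this.deriv_eq]; simp
  obtain ⟨C, hC⟩ := (isCompact_Icc (a := (0 : ℝ)) (b := 2)).exists_bound_of_continuousOn
    (f := fun t => 2 * t * deriv q t) (by fun_prop)
  have hC0 : 0 ≤ C := le_trans (norm_nonneg _) (hC 0 (by simp))
  have hCb : ∀ t, 0 ≤ t → -C ≤ 2 * t * deriv q t := by
    intro t ht
    rcases le_or_gt t 2 with h | h
    · exact (abs_le.1 (hC t ⟨ht, h⟩)).1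
    · rw [hd2 t h]; linarith
  refine ⟨C, hC0, fun R hR => ?_⟩
  have hR2 : 0 < R ^ 2 := by positivity
  have hval : ∀ s, 0 ≤ s → m * ((1 + s) ^ (-(m / 2)) * q (s / R ^ 2)) + 2 * s *
      ((1 * (-(m / 2)) * (1 + s) ^ (-(m / 2) - 1)) * q (s / R ^ 2)
        + (1 + s) ^ (-(m / 2)) * (deriv q (s / R ^ 2) * (1 / R ^ 2))) =
      m * (1 + s) ^ (-(m / 2) - 1) * q (s / R ^ 2)
        + (1 + s) ^ (-(m / 2)) * (2 * (s / R ^ 2) * deriv q (s / R ^ 2)) := by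
    intro s hs
    have h1 : (1 + s) ^ (-(m / 2)) = (1 + s) ^ (-(m / 2) - 1) * (1 + s) := by
      rw [Real.rpow_sub_one (by positivity)]; field_simp
    rw [h1]; field_simp; ring
  refine ⟨fun s => (1 + s) ^ (-(m / 2)) * q (s / R ^ 2), fun s =>
    (1 * (-(m / 2)) * (1 + s) ^ (-(m / 2) - 1)) * q (s / R ^ 2)
        + (1 + s) ^ (-(m / 2)) * (deriv q (s / R ^ 2) * (1 / R ^ 2)), ?_, ?_, ?_, ?_, ?_, ?_, ?_, ?_⟩
  · intro s hs
    refine ContDiffAt.mul ?_ ?_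
    · exact ContDiffAt.rpow_const_of_ne (by fun_prop) (by positivity)
    · exact (hq.comp (contDiff_id.div_const _)).contDiffAt
  · intro s hs
    have : 2 ≤ s / R ^ 2 := by rw [le_div_iff₀ hR2]; linarith
    simp [hq2 _ this]
  · intro s hs
    have g1 : HasDerivAt (fun s : ℝ => (1 + s) ^ (-(m / 2)))
        (1 * (-(m / 2)) * (1 + s) ^ (-(m / 2) - 1)) s :=
      ((hasDerivAt_id s).const_add 1).rpow_const (Or.inl (by simp; positivity))
    have g2 : HasDerivAt (fun s : ℝ => q (s / R ^ 2)) (deriv q (s / R ^ 2) * (1 / R ^ 2)) s :=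
      HasDerivAt.comp (h₂ := q) (h := fun s : ℝ => s / R ^ 2) s (hqd (s / R ^ 2))
        ((hasDerivAt_id s).div_const (R ^ 2))
    exact g1.mul g2
  · intro s hs
    have := hq0 (s / R ^ 2)
    positivity
  · intro s hs
    have i1 := hq0 (s / R ^ 2)
    have i2 : 0 ≤ - deriv q (s / R ^ 2) := neg_nonneg.2 (hq' _)
    have j1 : 0 ≤ m / 2 * (1 + s) ^ (-(m / 2) - 1) * q (s / R ^ 2) := by positivity
    have j2 : 0 ≤ (1 + s) ^ (-(m / 2)) * (- deriv q (s / R ^ 2) * (1 / R ^ 2)) := by positivity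
    simp only
    linarith
  · intro s hs hsR
    have : s / R ^ 2 < 1 := by rw [div_lt_one hR2]; exact hsR
    rw [hval s hs, hq1 _ this.le, hd1 _ this]; ring
  · intro s hs
    rw [hval s hs]
    have j1 : 0 ≤ m * (1 + s) ^ (-(m / 2) - 1) * q (s / R ^ 2) := by
      have := hq0 (s / R ^ 2)
      positivity
    have hRm : 0 < R ^ (-m) := by positivity
    rcases lt_or_ge s (R ^ 2) with h | h
    · have : s / R ^ 2 < 1 := by rw [div_lt_one hR2]; exact h
      rw [hd1 _ this]
      have : 0 ≤ C * R ^ (-m) := by positivity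
      linarith
    · have k1 : (1 + s) ^ (-(m / 2)) ≤ R ^ (-m) := by
        have : R ^ (-m) = (R ^ 2) ^ (-(m / 2)) := by
          rw [← Real.rpow_natCast, ← Real.rpow_mul (by positivity)]
          congr 1; push_cast; ring
        rw [this]
        exact Real.rpow_le_rpow_of_nonpos hR2 (by linarith) (by linarith)
      have k2 := hCb (s / R ^ 2) (by positivity)
      have k3 : 0 ≤ (1 + s) ^ (-(m / 2)) := by positivity
      have k4 := mul_le_mul_of_nonneg_left k2 k3
      have k5 := mul_le_mul_of_nonneg_left k1 hC0
      linarith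
  · intro s hs
    have : 2 < s / R ^ 2 := by rw [lt_div_iff₀ hR2]; linarith
    rw [hval s (by linarith), hq2 _ this.le, hd2 _ this]; ring

/-- Liouville theorem for Yang–Mills–Higgs pairs on `ℝⁿ` (`n > 4`):
if `(A, u)` is a Yang–Mills–Higgs pair (same setup as the YMH monotonicity theorem,
with `W ≥ 0`) whose total energy satisfies
`∫_{B_R(x₀)} (½|F_A|² + ½|d^∇u|² + W(|u|²)) = o(R^{n−4})` as `R → ∞`, then
`F_A ≡ 0`, `d^∇u ≡ 0` and `W(|u|²) ≡ 0`; in particular the connection is flat and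
`u` is parallel. -/
theorem stmt_18 (hn : 4 < n)
    (br : G →ₗ[ℝ] G →ₗ[ℝ] G) (ρ : G →ₗ[ℝ] V →ₗ[ℝ] V)
    (hbr_skew : ∀ X Y : G, br X Y = -br Y X)
    (hjacobi : ∀ X Y Z : G, br X (br Y Z) = br (br X Y) Z + br Y (br X Z))
    (hbr_inv : ∀ X Y Z : G, ⟪br X Y, Z⟫ = -⟪Y, br X Z⟫)
    (hρ_lie : ∀ X Y : G, ∀ v : V, ρ (br X Y) v = ρ X (ρ Y v) - ρ Y (ρ X v))
    (hρ_skew : ∀ (X : G) (v w : V), ⟪ρ X v, w⟫ = -⟪v, ρ X w⟫)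
    (A : EuclideanSpace ℝ (Fin n) → Fin n → G) (u : EuclideanSpace ℝ (Fin n) → V)
    (W : ℝ → ℝ) (hA : ∀ i, ContDiff ℝ (⊤ : ℕ∞) (fun x => A x i)) (hu : ContDiff ℝ (⊤ : ℕ∞) u)
    (hW : ContDiff ℝ (⊤ : ℕ∞) W) (hWpos : ∀ t, 0 ≤ W t)
    (h1 : YMH1 br ρ A u) (h2 : YMH2 ρ A u W)
    (x₀ : EuclideanSpace ℝ (Fin n))
    (hgrowth : (fun R : ℝ => ∫ x in Metric.ball x₀ R, eYMH18 br ρ A u W x)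
      =o[Filter.atTop] fun R : ℝ => R ^ ((n:ℝ) - 4)) :
    ∀ x : EuclideanSpace ℝ (Fin n),
      (∀ i j, curv18 br A x i j = 0) ∧ (∀ i, covD18 ρ A u x i = 0) ∧ W (‖u x‖ ^ 2) = 0 := by
  set e := eYMH18 br ρ A u W with he
  have hec : Continuous e := (cd_e18 br ρ hA hu hW).continuous
  have hen : ∀ x, 0 ≤ e x := e_nonneg18 br ρ A u hWpos
  have hm : 0 < (n : ℝ) - 4 := by
    have : (4 : ℝ) < n := by exact_mod_cast hn
    linarith
  set m : ℝ := (n : ℝ) - 4 with hmdef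
  have hloc : ∀ r, IntegrableOn e (Metric.ball x₀ r) := fun r =>
    ((hec.continuousOn).integrableOn_compact (isCompact_closedBall x₀ r)).mono_set
      Metric.ball_subset_closedBall
  obtain ⟨C, hC0, hcut⟩ := cut18 m hm
  -- main estimate
  have main : ∀ r : ℝ, 0 < r → ∀ R : ℝ, 1 ≤ R → r ≤ R →
      m * (1 + r ^ 2) ^ (-(m / 2) - 1) * ∫ x in Metric.ball x₀ r, e x ≤
        C * R ^ (-m) * ∫ x in Metric.ball x₀ (2 * R), e x := by
    intro r hr R hR hrR
    obtain ⟨φ, φ', c1, c2, c3, c4, c5, c6, c7, c8⟩ := hcut R hR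
    have hΦ : ContDiff ℝ (⊤ : ℕ∞) fun x : EuclideanSpace ℝ (Fin n) => φ (‖x - x₀‖ ^ 2) := by
      rw [contDiff_iff_contDiffAt]
      intro x
      have hns : ContDiff ℝ (⊤ : ℕ∞) fun x : EuclideanSpace ℝ (Fin n) => ‖x - x₀‖ ^ 2 :=
        (contDiff_id.sub contDiff_const).norm_sq ℝ
      exact ContDiffAt.comp x (g := φ) (c1 _ (sq_nonneg _)) hns.contDiffAt
    have hΦc : HasCompactSupport fun x : EuclideanSpace ℝ (Fin n) => φ (‖x - x₀‖ ^ 2) := by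
      refine HasCompactSupport.intro (isCompact_closedBall x₀ (2 * R)) fun x hx => ?_
      rw [Metric.mem_closedBall, dist_eq_norm, not_le] at hx
      exact c2 _ (by nlinarith)
    obtain ⟨I, hI1, hI2, hI3⟩ := ineq18 br ρ hbr_skew hjacobi hbr_inv hρ_lie hρ_skew hA hu hW hWpos
      h1 h2 x₀ φ φ' hΦ hΦc c3 c4 c5
    have f1 : Integrable ((Metric.ball x₀ r).indicator
        (fun x => m * (1 + r ^ 2) ^ (-(m / 2) - 1) * e x)) :=
      (integrable_indicator_iff Metric.isOpen_ball.measurableSet).2 ((hloc r).const_mul _)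
    have f2 : Integrable ((Metric.ball x₀ (2 * R)).indicator
        (fun x => C * R ^ (-m) * e x)) :=
      (integrable_indicator_iff Metric.isOpen_ball.measurableSet).2 ((hloc (2 * R)).const_mul _)
    have hR0 : 0 ≤ C * R ^ (-m) := by positivity
    have hle : ∀ x, ((Metric.ball x₀ r).indicator
        (fun x => m * (1 + r ^ 2) ^ (-(m / 2) - 1) * e x) x) - ((Metric.ball x₀ (2 * R)).indicator
        (fun x => C * R ^ (-m) * e x) x) ≤ I x := by
      intro x
      refine le_trans ?_ (hI3 x)
      have hs0 : 0 ≤ ‖x - x₀‖ ^ 2 := sq_nonneg _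
      have hx0 := norm_nonneg (x - x₀)
      have hex := hen x
      by_cases hx : x ∈ Metric.ball x₀ r
      · have hxn : ‖x - x₀‖ < r := by rwa [← dist_eq_norm]
        have hx2 : x ∈ Metric.ball x₀ (2 * R) := by
          rw [Metric.mem_ball, dist_eq_norm]; linarith
        rw [indicator_of_mem hx, indicator_of_mem hx2, c6 _ hs0 (by nlinarith)]
        have : (1 + r ^ 2) ^ (-(m / 2) - 1) ≤ (1 + ‖x - x₀‖ ^ 2) ^ (-(m / 2) - 1) :=
          Real.rpow_le_rpow_of_nonpos (by positivity) (by nlinarith) (by linarith)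
        have t1 := mul_le_mul_of_nonneg_right (mul_le_mul_of_nonneg_left this hm.le) hex
        have t2 := mul_nonneg hR0 hex
        linarith
      · rw [indicator_of_notMem hx]
        by_cases hx2 : x ∈ Metric.ball x₀ (2 * R)
        · rw [indicator_of_mem hx2]
          have := mul_le_mul_of_nonneg_right (c7 _ hs0) hex
          linarith
        · rw [indicator_of_notMem hx2]
          rw [Metric.mem_ball, dist_eq_norm, not_lt] at hx2
          rw [c8 _ (by nlinarith)]
          simp
    have hint := integral_mono (f1.sub f2) hI1 hle
    rw [hI2] at hint
    simp only [Pi.sub_apply] at hint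
    rw [integral_sub f1 f2, integral_indicator Metric.isOpen_ball.measurableSet,
      integral_indicator Metric.isOpen_ball.measurableSet, integral_const_mul,
      integral_const_mul] at hint
    linarith
  -- passage to the limit
  have hlim : Filter.Tendsto (fun R : ℝ => C * R ^ (-m) * ∫ x in Metric.ball x₀ (2 * R), e x)
      Filter.atTop (nhds 0) := by
    have t1 := hgrowth.tendsto_div_nhds_zero
    have t2 : Filter.Tendsto (fun R : ℝ => 2 * R) Filter.atTop Filter.atTop :=
      Filter.tendsto_id.const_mul_atTop (by norm_num)
    have t3 := (t1.comp t2).const_mul (C * 2 ^ m)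
    rw [mul_zero] at t3
    refine t3.congr' ?_
    filter_upwards [Filter.eventually_gt_atTop 0] with R hR
    simp only [Function.comp]
    rw [Real.mul_rpow (by norm_num) hR.le, Real.rpow_neg hR.le]
    have : (0 : ℝ) < 2 ^ m := by positivity
    have : 0 < R ^ m := by positivity
    field_simp
  have hzero : ∀ x, e x = 0 := by
    intro x
    set r := ‖x - x₀‖ + 1 with hrdef
    have hr : 0 < r := by positivity
    have hle : m * (1 + r ^ 2) ^ (-(m / 2) - 1) * ∫ x in Metric.ball x₀ r, e x ≤ 0 := by
      refine ge_of_tendsto hlim ?_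
      filter_upwards [Filter.eventually_ge_atTop 1, Filter.eventually_ge_atTop r] with R h1 h2
      exact main r hr R h1 h2
    have hpos : 0 < m * (1 + r ^ 2) ^ (-(m / 2) - 1) := by positivity
    have hi0 : ∫ x in Metric.ball x₀ r, e x = 0 :=
      le_antisymm (nonpos_of_mul_nonpos_right hle hpos) (integral_nonneg hen)
    rw [setIntegral_eq_zero_iff_of_nonneg_ae (Filter.Eventually.of_forall hen) (hloc r)] at hi0
    have := Measure.eqOn_open_of_ae_eq hi0 Metric.isOpen_ball hec.continuousOn continuousOn_const
    exact this (by rw [Metric.mem_ball, dist_eq_norm]; linarith)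
  intro x
  have hx := hzero x
  rw [he] at hx
  unfold eYMH18 at hx
  have w0 := hWpos (‖u x‖ ^ 2)
  have s1 : 0 ≤ ∑ i, ∑ j, ‖curv18 br A x i j‖ ^ 2 := by positivity
  have s2 : 0 ≤ ∑ i, ‖covD18 ρ A u x i‖ ^ 2 := by positivity
  refine ⟨?_, ?_, by linarith⟩
  · intro i j
    have z1 : ∑ i, ∑ j, ‖curv18 br A x i j‖ ^ 2 = 0 := by linarith
    rw [Finset.sum_eq_zero_iff_of_nonneg (fun i _ => by positivity)] at z1
    have z2 := z1 i (Finset.mem_univ _)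
    rw [Finset.sum_eq_zero_iff_of_nonneg (fun i _ => by positivity)] at z2
    simpa using z2 j (Finset.mem_univ _)
  · intro i
    have z1 : ∑ i, ‖covD18 ρ A u x i‖ ^ 2 = 0 := by linarith
    rw [Finset.sum_eq_zero_iff_of_nonneg (fun i _ => by positivity)] at z1
    simpa using z1 i (Finset.mem_univ _)

end YMH

end
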